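/- arXiv:2307.01074 — 2 statements merged into one kernel-verified Lean document; each statement's English description precedes it below -/
import Mathlib

section
/- Let 0 ≤ a ≤ b and t > 0. Then the quantity I(t,a,b) = (1/(4π)) ∫_ℝ h_t(λ)·λ·coth(πλ) dλ, where h_t is the Gaussian mollification of the indicator of [a,b] at scale 1/t, satisfies |I(t,a,b) - (1/(4π)) ∫_a^b λ·coth(πλ) dλ| ≤ (b+1)/(2t) + 1/(2t²). -/
open Real MeasureTheory

/-- The spectral density `λ ↦ λ·coth(πλ)`, extended by its limit `1/π` at `λ = 0`. -/
noncomputable def cothDensity (l : ℝ) : ℝ :=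
  if l = 0 then 1 / π else l * (Real.cosh (π * l) / Real.sinh (π * l))

theorem cothDensity_eq_cosh_div_dslope (x : ℝ) :
    cothDensity x = cosh (π * x) / dslope (fun y => sinh (π * y)) 0 x := by
  unfold cothDensity
  split_ifs with h
  · subst h
    have h0 : HasDerivAt (fun y => sinh (π * y)) (cosh (π * 0) * (π * 1)) 0 :=
      ((hasDerivAt_id (0 : ℝ)).const_mul π).sinh
    rw [dslope_same, h0.deriv]
    simp
  · rw [dslope_of_ne _ h, slope_def_field]
    have hs : sinh (π * x) ≠ 0 := by simp [pi_ne_zero, h]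
    simp only [mul_zero, sinh_zero, sub_zero]
    field_simp

theorem continuous_cothDensity : Continuous cothDensity := by
  have hd : Differentiable ℝ fun y => sinh (π * y) := by fun_prop
  have hc : Continuous (dslope (fun y => sinh (π * y)) 0) :=
    continuousOn_univ.1
      ((continuousOn_dslope Filter.univ_mem).2 ⟨hd.continuous.continuousOn, hd 0⟩)
  rw [funext cothDensity_eq_cosh_div_dslope]
  refine Continuous.div (by fun_prop) hc fun x => ?_
  rcases eq_or_ne x 0 with rfl | h
  · have h0 : HasDerivAt (fun y => sinh (π * y)) (cosh (π * 0) * (π * 1)) 0 :=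
      ((hasDerivAt_id (0 : ℝ)).const_mul π).sinh
    rw [dslope_same, h0.deriv]
    simp [pi_ne_zero]
  · rw [dslope_of_ne _ h, slope_def_field]
    simp [pi_ne_zero, h]

theorem cothDensity_neg (x : ℝ) : cothDensity (-x) = cothDensity x := by
  simp [cothDensity, div_neg]

theorem cothDensity_abs (x : ℝ) : cothDensity |x| = cothDensity x := by
  rcases abs_choice x with h | h <;> simp [h, cothDensity_neg]

theorem hasDerivAt_cothDensity {x : ℝ} (hx : 0 < x) :
    HasDerivAt cothDensity
      ((sinh (π * x) * cosh (π * x) - π * x) / sinh (π * x) ^ 2) x := by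
  have hs : sinh (π * x) ≠ 0 := by simp [pi_ne_zero, hx.ne']
  have hm : HasDerivAt (fun y : ℝ => π * y) π x := by
    simpa using (hasDerivAt_id x).const_mul π
  have h : HasDerivAt (fun y => y * (cosh (π * y) / sinh (π * y))) _ x :=
    (hasDerivAt_id' x).mul (hm.cosh.div hm.sinh hs)
  refine (h.congr_of_eventuallyEq ?_).congr_deriv ?_
  · filter_upwards [eventually_ne_nhds hx.ne'] with y hy
    simp [cothDensity, hy]
  · have := cosh_sq (π * x)
    field_simp
    rw [this]
    ring

theorem monotoneOn_cothDensity : MonotoneOn cothDensity (Set.Ici 0) := by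
  refine monotoneOn_of_deriv_nonneg (convex_Ici 0) continuous_cothDensity.continuousOn
    (fun x hx => ?_) fun x hx => ?_ <;> rw [interior_Ici, Set.mem_Ioi] at hx
  · exact (hasDerivAt_cothDensity hx).differentiableAt.differentiableWithinAt
  · rw [(hasDerivAt_cothDensity hx).deriv]
    have hp : 0 ≤ π * x := by positivity
    have h1 := self_le_sinh_iff.2 hp
    have h2 := one_le_cosh (π * x)
    apply div_nonneg _ (sq_nonneg _)
    nlinarith

theorem antitoneOn_cothDensity_sub_id :
    AntitoneOn (fun x => cothDensity x - x) (Set.Ici 0) := by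
  refine antitoneOn_of_deriv_nonpos (convex_Ici 0)
    (continuous_cothDensity.sub continuous_id).continuousOn
    (fun x hx => ?_) fun x hx => ?_ <;> rw [interior_Ici, Set.mem_Ioi] at hx
  · exact ((hasDerivAt_cothDensity hx).sub
      (hasDerivAt_id' x)).differentiableAt.differentiableWithinAt
  · have hd : HasDerivAt (fun y => cothDensity y - y) _ x :=
      (hasDerivAt_cothDensity hx).sub (hasDerivAt_id' x)
    rw [hd.deriv, sub_nonpos]
    have hp : 0 < π * x := by positivity
    have hs : 0 < sinh (π * x) := sinh_pos_iff.2 hp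
    rw [div_le_one (by positivity)]
    have h1 : sinh (π * x) * (cosh (π * x) - sinh (π * x)) =
        (1 - exp (-(2 * (π * x)))) / 2 := by
      rw [cosh_sub_sinh, sinh_eq, show -(2 * (π * x)) = -(π * x) + -(π * x) by ring, exp_add]
      have : exp (π * x) * exp (-(π * x)) = 1 := by rw [← exp_add]; simp
      linear_combination this / 2
    have h2 := add_one_le_exp (-(2 * (π * x)))
    nlinarith

/-- `λ ↦ λ·coth(πλ)` is `1`-Lipschitz. -/
theorem abs_cothDensity_sub_le (x y : ℝ) : |cothDensity x - cothDensity y| ≤ |x - y| := by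
  rw [← cothDensity_abs x, ← cothDensity_abs y]
  refine le_trans ?_ (abs_abs_sub_abs_le x y)
  generalize hu : |x| = u
  generalize hv : |y| = v
  have hu0 : 0 ≤ u := hu ▸ abs_nonneg x
  have hv0 : 0 ≤ v := hv ▸ abs_nonneg y
  clear hu hv
  wlog h : u ≤ v generalizing u v
  · rw [abs_sub_comm, abs_sub_comm u]
    exact this v u hv0 hu0 (le_of_not_ge h)
  have h1 := monotoneOn_cothDensity hu0 hv0 h
  have h2 := antitoneOn_cothDensity_sub_id hu0 hv0 h
  simp only at h2
  rw [abs_of_nonpos (by linarith), abs_of_nonpos (by linarith)]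
  linarith

theorem integral_abs_mul_exp_neg_mul_sq {c : ℝ} (hc : 0 < c) :
    ∫ x : ℝ, |x| * exp (-c * x ^ 2) = 1 / c := by
  have h := integral_comp_abs (f := fun x => x * exp (-c * x ^ 2))
  simp only [sq_abs] at h
  have h' := integral_rpow_mul_exp_neg_mul_rpow (p := 2) (q := 1) two_pos (by norm_num) hc
  norm_num [← neg_mul] at h'
  rw [h, h', rpow_neg_one]
  ring

theorem integrable_abs_mul_exp_neg_mul_sq {c : ℝ} (hc : 0 < c) :
    Integrable fun x : ℝ => |x| * exp (-c * x ^ 2) := by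
  refine (integrable_mul_exp_neg_mul_sq hc).abs.congr (ae_of_all _ fun x => ?_)
  simp [abs_mul]

section GaussianMollification

variable {g : ℝ → ℝ} {t : ℝ}

theorem integrable_exp_mul_of_lipschitz (hg : ∀ x y, |g x - g y| ≤ |x - y|)
    (hgc : Continuous g) (ht : 0 < t) (r : ℝ) :
    Integrable fun x => exp (-t ^ 2 * (x - r) ^ 2) * g x := by
  have ht2 : 0 < t ^ 2 := by positivity
  have hk : Integrable fun x : ℝ =>
      |x| * exp (-t ^ 2 * x ^ 2) + |g r| * exp (-t ^ 2 * x ^ 2) :=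
    (integrable_abs_mul_exp_neg_mul_sq ht2).add ((integrable_exp_neg_mul_sq ht2).const_mul _)
  refine (hk.comp_sub_right r).mono' (by fun_prop) (ae_of_all _ fun x => ?_)
  rw [norm_mul, norm_of_nonneg (exp_pos _).le, norm_eq_abs, ← add_mul, mul_comm]
  gcongr
  have := abs_sub_abs_le_abs_sub (g x) (g r)
  linarith [hg x r]

/-- Gaussian mollification at scale `1/t` moves a `1`-Lipschitz function by at most
`1/(t√π)`. -/
theorem abs_gaussian_mollification_sub_le (hg : ∀ x y, |g x - g y| ≤ |x - y|)
    (hgc : Continuous g) (ht : 0 < t) (r : ℝ) :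
    |(t / √π) * (∫ x, exp (-t ^ 2 * (x - r) ^ 2) * g x) - g r| ≤ 1 / (t * √π) := by
  have ht2 : 0 < t ^ 2 := by positivity
  have hmass : (t / √π) * ∫ x, exp (-t ^ 2 * (x - r) ^ 2) = 1 := by
    rw [integral_sub_right_eq_self (fun x => exp (-t ^ 2 * x ^ 2)) r, integral_gaussian,
      sqrt_div pi_pos.le, sqrt_sq ht.le]
    have : √π ≠ 0 := (sqrt_pos.2 pi_pos).ne'
    field_simp
  have hint : Integrable fun x => exp (-t ^ 2 * (x - r) ^ 2) :=
    (integrable_exp_neg_mul_sq ht2).comp_sub_right r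
  have hsub : (t / √π) * (∫ x, exp (-t ^ 2 * (x - r) ^ 2) * g x) - g r =
      (t / √π) * ∫ x, exp (-t ^ 2 * (x - r) ^ 2) * (g x - g r) := by
    simp only [mul_sub]
    rw [integral_sub (integrable_exp_mul_of_lipschitz hg hgc ht r) (hint.mul_const _),
      integral_mul_const]
    linear_combination g r * hmass
  have hbound : |∫ x, exp (-t ^ 2 * (x - r) ^ 2) * (g x - g r)| ≤ 1 / t ^ 2 := by
    rw [← integral_abs_mul_exp_neg_mul_sq ht2,
      ← integral_sub_right_eq_self (fun x => |x| * exp (-t ^ 2 * x ^ 2)) r, ← norm_eq_abs]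
    refine norm_integral_le_of_norm_le
      ((integrable_abs_mul_exp_neg_mul_sq ht2).comp_sub_right r) (ae_of_all _ fun x => ?_)
    rw [norm_mul, norm_of_nonneg (exp_pos _).le, norm_eq_abs, mul_comm]
    exact mul_le_mul_of_nonneg_right (hg x r) (exp_pos _).le
  rw [hsub, abs_mul, abs_of_nonneg (by positivity)]
  calc t / √π * |∫ x, exp (-t ^ 2 * (x - r) ^ 2) * (g x - g r)|
      ≤ t / √π * (1 / t ^ 2) := by gcongr
    _ = 1 / (t * √π) := by field_simp

theorem integrable_prod_exp_mul_of_lipschitz (hg : ∀ x y, |g x - g y| ≤ |x - y|)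
    (hgc : Continuous g) (ht : 0 < t) (a b : ℝ) :
    Integrable (Function.uncurry fun x r => exp (-t ^ 2 * (x - r) ^ 2) * g x)
      (volume.prod (volume.restrict (Set.Ioc a b))) := by
  have ht2 : 0 < t ^ 2 := by positivity
  have hk : Integrable fun x : ℝ =>
      |x| * exp (-t ^ 2 * x ^ 2) + (|g a| + |b - a|) * exp (-t ^ 2 * x ^ 2) :=
    (integrable_abs_mul_exp_neg_mul_sq ht2).add ((integrable_exp_neg_mul_sq ht2).const_mul _)
  have hconv := (integrable_const (μ := volume.restrict (Set.Ioc a b))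
    (1 : ℝ)).convolution_integrand (ContinuousLinearMap.mul ℝ ℝ) hk
  have hmem : ∀ᵐ p : ℝ × ℝ ∂(volume.prod (volume.restrict (Set.Ioc a b))),
      p.2 ∈ Set.Ioc a b :=
    Measure.quasiMeasurePreserving_snd.ae (ae_restrict_mem measurableSet_Ioc)
  refine hconv.mono' (Continuous.aestronglyMeasurable (by fun_prop)) ?_
  filter_upwards [hmem] with p hp
  simp only [Function.uncurry, ContinuousLinearMap.mul_apply', one_mul]
  rw [norm_mul, norm_of_nonneg (exp_pos _).le, norm_eq_abs, ← add_mul, mul_comm]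
  gcongr
  have h1 := abs_sub_abs_le_abs_sub (g p.1) (g p.2)
  have h2 := abs_sub_abs_le_abs_sub (g p.2) (g a)
  have h3 : |p.2 - a| ≤ |b - a| := abs_le_abs_of_nonneg (by linarith [hp.1]) (by linarith [hp.2])
  linarith [hg p.1 p.2, hg p.2 a]

theorem abs_integral_gaussian_mollified_indicator_sub_le
    (hg : ∀ x y, |g x - g y| ≤ |x - y|) (hgc : Continuous g) (ht : 0 < t) {a b : ℝ}
    (hab : a ≤ b) :
    |(∫ x, ((t / √π) * ∫ r in a..b, exp (-t ^ 2 * (x - r) ^ 2)) * g x) - ∫ r in a..b, g r| ≤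
      (b - a) / (t * √π) := by
  have hprod := integrable_prod_exp_mul_of_lipschitz hg hgc ht a b
  have hswap : (∫ x, ((t / √π) * ∫ r in a..b, exp (-t ^ 2 * (x - r) ^ 2)) * g x) =
      ∫ r in a..b, (t / √π) * ∫ x, exp (-t ^ 2 * (x - r) ^ 2) * g x := by
    simp only [intervalIntegral.integral_of_le hab]
    rw [integral_const_mul, ← integral_integral_swap hprod, ← integral_const_mul]
    congr 1 with x
    rw [integral_mul_const, mul_assoc]
  have hi : IntervalIntegrable (fun r => (t / √π) * ∫ x, exp (-t ^ 2 * (x - r) ^ 2) * g x)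
      volume a b :=
    (intervalIntegrable_iff_integrableOn_Ioc_of_le hab).2 (hprod.integral_prod_right.const_mul _)
  rw [hswap, ← intervalIntegral.integral_sub hi (hgc.intervalIntegrable a b), ← norm_eq_abs]
  refine (intervalIntegral.norm_integral_le_of_norm_le_const fun r _ =>
    abs_gaussian_mollification_sub_le hg hgc ht r).trans_eq ?_
  rw [abs_of_nonneg (sub_nonneg.2 hab)]
  ring

end GaussianMollification

theorem integral_term_estimate (a b t : ℝ) (ha : 0 ≤ a) (hab : a ≤ b) (ht : 0 < t) :
    |(1 / (4 * π)) *
        (∫ l : ℝ, ((t / Real.sqrt π) * ∫ ρ in a..b, Real.exp (-t ^ 2 * (l - ρ) ^ 2)) *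
          cothDensity l) -
      (1 / (4 * π)) * ∫ l in a..b, cothDensity l| ≤
    (b + 1) / (2 * t) + 1 / (2 * t ^ 2) := by
  rw [← mul_sub, abs_mul, abs_of_nonneg (by positivity)]
  have h := abs_integral_gaussian_mollified_indicator_sub_le abs_cothDensity_sub_le
    continuous_cothDensity ht hab
  have hsqrt : 1 ≤ √π := one_le_sqrt.2 (by linarith [pi_gt_three])
  have hpi : 1 / (4 * π) ≤ 1 / 2 := by
    gcongr
    linarith [pi_gt_three]
  calc _ ≤ 1 / 2 * ((b - a) / (t * √π)) := by gcongr
    _ ≤ 1 / 2 * ((b + 1) / (t * 1)) := by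
      gcongr
      · linarith
      · linarith
    _ = (b + 1) / (2 * t) := by field_simp
    _ ≤ (b + 1) / (2 * t) + 1 / (2 * t ^ 2) := le_add_of_nonneg_right (by positivity)
end

section
/- Let 0 < r ≤ 2 and let Γ be a discrete group of isometries of the hyperbolic plane ℍ such that for every z ∈ ℍ and every γ ∈ Γ with γ ≠ 1, d(z, γz) ≥ 2r (i.e., the injectivity radius of Γ\ℍ is at least r everywhere). Then for any j > 0 and any z ∈ ℍ, the number of elements γ ∈ Γ \ {1} with d(z, γz) ≤ j is at most 4e^{1+j}/r². -/
open Real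

local notation "ℍ" => UpperHalfPlane

open MeasureTheory Set

open scoped ENNReal

/-- Integrating by horizontal slices over a region that is symmetric about a vertical line. -/
lemma setLIntegral_re_sub_sq_lt (x : ℝ) {g : ℝ → ℝ} (hg : Measurable g) {h : ℝ → ℝ≥0∞}
    (hh : Measurable h) :
    ∫⁻ w : ℂ in {w : ℂ | (w.re - x) ^ 2 < g w.im}, h w.im =
      ∫⁻ y, h y * ENNReal.ofReal (2 * √(g y)) := by
  have hS : MeasurableSet {w : ℂ | (w.re - x) ^ 2 < g w.im} :=
    measurableSet_lt (by fun_prop) (hg.comp Complex.measurable_im)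
  have hT : MeasurableSet {p : ℝ × ℝ | (p.1 - x) ^ 2 < g p.2} :=
    measurableSet_lt (by fun_prop) (hg.comp measurable_snd)
  rw [← lintegral_indicator hS,
    ← Complex.volume_preserving_equiv_real_prod.symm.lintegral_comp_emb
      Complex.measurableEquivRealProd.symm.measurableEmbedding, Measure.volume_eq_prod]
  have hind : (fun p : ℝ × ℝ ↦ indicator {w : ℂ | (w.re - x) ^ 2 < g w.im} (fun w ↦ h w.im)
      (Complex.measurableEquivRealProd.symm p)) =
      indicator {p : ℝ × ℝ | (p.1 - x) ^ 2 < g p.2} (fun p ↦ h p.2) := by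
    ext p
    rw [Complex.measurableEquivRealProd_symm_apply]
    rfl
  have hmeas : Measurable (indicator {p : ℝ × ℝ | (p.1 - x) ^ 2 < g p.2} fun p ↦ h p.2) :=
    (hh.comp measurable_snd).indicator hT
  rw [hind, lintegral_prod_symm' _ hmeas]
  refine lintegral_congr fun y ↦ ?_
  have hslice : (fun t ↦ indicator {p : ℝ × ℝ | (p.1 - x) ^ 2 < g p.2} (fun p ↦ h p.2) (t, y)) =
      indicator (Ioo (x - √(g y)) (x + √(g y))) fun _ ↦ h y := by
    ext t
    have : (t - x) ^ 2 < g y ↔ t ∈ Ioo (x - √(g y)) (x + √(g y)) := by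
      rw [Real.sq_lt, mem_Ioo]
      constructor <;> rintro ⟨h₁, h₂⟩ <;> constructor <;> linarith
    simp only [indicator, mem_ofPred_eq, this]
  rw [hslice, lintegral_indicator_const measurableSet_Ioo, Real.volume_Ioo]
  ring_nf

lemma lintegral_sqrt_sq_sub_sq {a : ℝ} (ha : 0 ≤ a) :
    ∫⁻ u : ℝ, ENNReal.ofReal (2 * √(a ^ 2 - u ^ 2)) = ENNReal.ofReal (π * a ^ 2) := by
  have hball : {w : ℂ | (w.re - 0) ^ 2 < a ^ 2 - w.im ^ 2} = Metric.ball 0 a := by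
    ext w
    rw [mem_ball_zero_iff, ← sq_lt_sq₀ (norm_nonneg w) ha, Complex.sq_norm, Complex.normSq_apply]
    simp only [mem_ofPred_eq]
    constructor <;> intro h <;> linarith
  have h := setLIntegral_re_sub_sq_lt 0 (g := fun u ↦ a ^ 2 - u ^ 2) (by fun_prop)
    (h := fun _ ↦ 1) measurable_const
  simp only [one_mul] at h
  rw [← h, hball, setLIntegral_one, Complex.volume_ball, ENNReal.ofReal_mul pi_pos.le,
    ENNReal.ofReal_pow ha, mul_comm, ← NNReal.coe_real_pi, ENNReal.ofReal_coe_nnreal]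

namespace UpperHalfPlane

lemma image_coe_ball_eq_setOf (z : UpperHalfPlane) {R : ℝ} (hR : 0 ≤ R) :
    UpperHalfPlane.coe '' Metric.ball z R =
      {w : ℂ | (w.re - z.re) ^ 2 < 4 * sinh (R / 2) ^ 2 * z.im * w.im - (w.im - z.im) ^ 2} := by
  have key (w : UpperHalfPlane) : dist w z < R ↔
      (w.re - z.re) ^ 2 < 4 * sinh (R / 2) ^ 2 * z.im * w.im - (w.im - z.im) ^ 2 := by
    have hs : 0 ≤ sinh (R / 2) := sinh_nonneg_iff.2 (by linarith)
    have hzw : 0 < w.im * z.im := mul_pos w.im_pos z.im_pos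
    rw [← div_lt_div_iff_of_pos_right (zero_lt_two' ℝ), ← sinh_lt_sinh, sinh_half_dist,
      div_lt_iff₀ (by positivity), ← sq_lt_sq₀ dist_nonneg (by positivity), mul_pow, mul_pow,
      sq_sqrt hzw.le, Complex.dist_eq, Complex.sq_norm, Complex.normSq_apply]
    simp only [Complex.sub_re, Complex.sub_im, coe_re, coe_im]
    constructor <;> intro h <;> linarith
  ext w
  constructor
  · rintro ⟨w, hw, rfl⟩
    exact (key w).1 hw
  · intro hw
    have him : 0 < w.im := by
      have hw' : (w.re - z.re) ^ 2 <
        4 * sinh (R / 2) ^ 2 * z.im * w.im - (w.im - z.im) ^ 2 := hw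
      have hpos : 0 < 4 * sinh (R / 2) ^ 2 * z.im * w.im := by
        linarith [sq_nonneg (w.re - z.re), sq_nonneg (w.im - z.im)]
      exact pos_of_mul_pos_right hpos (mul_nonneg (by positivity) z.im_pos.le)
    exact ⟨⟨w, him⟩, (key ⟨w, him⟩).2 hw, rfl⟩

/-- The measure of a hyperbolic disk as an integral over the logarithm of the height. -/
lemma volume_ball_eq_lintegral_exp (z : UpperHalfPlane) {R : ℝ} (hR : 0 ≤ R) :
    volume (Metric.ball z R) =
      ∫⁻ t : ℝ, ENNReal.ofReal (4 * √(sinh (R / 2) ^ 2 - sinh (t / 2) ^ 2) * exp (-(t / 2))) := by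
  have hz := z.im_pos
  set a := sinh (R / 2)
  rw [volume_eq_lintegral, image_coe_ball_eq_setOf z hR,
    setLIntegral_re_sub_sq_lt z.re (g := fun y ↦ 4 * a ^ 2 * z.im * y - (y - z.im) ^ 2)
      (by fun_prop) (h := fun y ↦ ((1 / ‖y‖₊) ^ 2 : NNReal)) (by fun_prop)]
  have hsupp : ∀ y ∉ Ioi (0 : ℝ), (((1 / ‖y‖₊) ^ 2 : NNReal) : ℝ≥0∞) *
      ENNReal.ofReal (2 * √(4 * a ^ 2 * z.im * y - (y - z.im) ^ 2)) = 0 := by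
    intro y hy
    have hy' : y ≤ 0 := not_lt.1 hy
    rw [Real.sqrt_eq_zero_of_nonpos]
    · simp
    · have : 4 * a ^ 2 * z.im * y ≤ 0 := mul_nonpos_of_nonneg_of_nonpos (by positivity) hy'
      linarith [sq_nonneg (y - z.im)]
  have himage : (fun t ↦ z.im * exp t) '' univ = Ioi 0 := by
    rw [image_univ]
    ext y
    constructor
    · rintro ⟨t, rfl⟩
      exact mul_pos hz (exp_pos t)
    · intro hy
      refine ⟨log (y / z.im), ?_⟩
      simp only [exp_log (div_pos hy hz)]
      field_simp
  rw [← setLIntegral_eq_of_support_subset (s := Ioi 0) (fun y hy ↦ by_contra fun h ↦ hy (hsupp y h)),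
    ← himage, lintegral_image_eq_lintegral_abs_deriv_mul MeasurableSet.univ
      (f' := fun t ↦ z.im * exp t) (fun t _ ↦ ((hasDerivAt_exp t).const_mul _).hasDerivWithinAt)
      (fun s _ t _ h ↦ exp_injective (mul_left_cancel₀ hz.ne' h)), setLIntegral_univ]
  refine lintegral_congr fun t ↦ ?_
  have hexp : exp t = exp (t / 2) ^ 2 := by
    rw [← exp_nat_mul]
    ring_nf
  have hroot : 4 * a ^ 2 * z.im * (z.im * exp t) - (z.im * exp t - z.im) ^ 2 =
      (2 * z.im * exp (t / 2)) ^ 2 * (a ^ 2 - sinh (t / 2) ^ 2) := by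
    rw [hexp, sinh_eq, exp_neg]
    field_simp
    ring
  have hcoe : (((1 / ‖z.im * exp t‖₊) ^ 2 : NNReal) : ℝ≥0∞) =
      ENNReal.ofReal ((1 / (z.im * exp t)) ^ 2) := by
    rw [ENNReal.ofReal, ENNReal.coe_inj]
    ext
    rw [coe_toNNReal _ (by positivity)]
    push_cast
    rw [norm_of_nonneg (by positivity)]
  rw [hcoe, hroot, Real.sqrt_mul (by positivity), Real.sqrt_sq (by positivity),
    abs_of_pos (by positivity), ← ENNReal.ofReal_mul (by positivity),
    ← ENNReal.ofReal_mul (by positivity), hexp, exp_neg]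
  congr 1
  field_simp
  ring

theorem volume_ball (z : UpperHalfPlane) {R : ℝ} (hR : 0 ≤ R) :
    volume (Metric.ball z R) = ENNReal.ofReal (4 * π * sinh (R / 2) ^ 2) := by
  set a := sinh (R / 2) with ha
  have ha0 : 0 ≤ a := sinh_nonneg_iff.2 (by linarith)
  have himage : (fun t ↦ sinh (t / 2)) '' univ = univ := by
    rw [image_univ]
    refine Function.Surjective.range_eq fun u ↦ ⟨2 * arsinh u, ?_⟩
    simp
  have hdisk : ENNReal.ofReal (π * a ^ 2) = ∫⁻ t : ℝ, ENNReal.ofReal |cosh (t / 2) * (1 / 2)| *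
      ENNReal.ofReal (2 * √(a ^ 2 - sinh (t / 2) ^ 2)) := by
    rw [← lintegral_sqrt_sq_sub_sq ha0, ← setLIntegral_univ, ← himage,
      lintegral_image_eq_lintegral_abs_deriv_mul MeasurableSet.univ
        (f := fun t ↦ sinh (t / 2)) (f' := fun t ↦ cosh (t / 2) * (1 / 2))
        (fun t _ ↦ (((hasDerivAt_id t).div_const 2).sinh).hasDerivWithinAt)
        (fun s _ t _ h ↦ by linarith [sinh_injective h]), setLIntegral_univ]
  have hdouble : volume (Metric.ball z R) + volume (Metric.ball z R) =
      8 * ENNReal.ofReal (π * a ^ 2) := by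
    have hneg := (volume_ball_eq_lintegral_exp z hR).trans (lintegral_neg_eq_self _).symm
    nth_rw 1 [hneg]
    rw [volume_ball_eq_lintegral_exp z hR, ← lintegral_add_left (by fun_prop), hdisk,
      ← lintegral_const_mul _ (by fun_prop)]
    refine lintegral_congr fun t ↦ ?_
    rw [neg_div, sinh_neg, neg_sq, neg_neg, abs_of_pos (by positivity),
      ← ENNReal.ofReal_add (by positivity) (by positivity), ← ENNReal.ofReal_mul (by positivity),
      ← ENNReal.ofReal_ofNat, ← ENNReal.ofReal_mul (by positivity), cosh_eq]
    congr 1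
    ring
  rw [← two_mul, ← ENNReal.ofReal_ofNat 8, ← ENNReal.ofReal_mul (by positivity)] at hdouble
  rw [← ENNReal.mul_right_inj two_ne_zero ENNReal.ofNat_ne_top, hdouble, ← ENNReal.ofReal_ofNat 2,
    ← ENNReal.ofReal_mul (by positivity)]
  congr 1
  ring

end UpperHalfPlane

lemma sinh_sq_le_exp_div_four {x : ℝ} (hx : 0 ≤ x) : sinh x ^ 2 ≤ exp (2 * x) / 4 := by
  have h : sinh x ≤ exp x / 2 := by
    rw [sinh_eq]
    linarith [exp_pos (-x)]
  calc sinh x ^ 2 ≤ (exp x / 2) ^ 2 := by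
        gcongr
    _ = exp (2 * x) / 4 := by
        rw [two_mul, exp_add]
        ring

/-- A packing bound: `2s`-separated points of a hyperbolic disk of radius `j`. -/
lemma card_mul_sq_le_exp_of_separated {ι : Type*} (F : Finset ι) (p : ι → ℍ) (z : ℍ) {s j : ℝ}
    (hs : 0 ≤ s) (hj : 0 ≤ j) (hsep : (F : Set ι).Pairwise fun i k ↦ 2 * s ≤ dist (p i) (p k))
    (hp : ∀ i ∈ F, dist z (p i) ≤ j) : (F.card : ℝ) * s ^ 2 ≤ exp (j + s) := by
  have hdisj : (F : Set ι).PairwiseDisjoint fun i ↦ Metric.ball (p i) s := by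
    intro i hi k hk hik
    have := hsep hi hk hik
    exact Metric.ball_disjoint_ball (by linarith)
  have hsub : ⋃ i ∈ F, Metric.ball (p i) s ⊆ Metric.ball z (j + s) :=
    iUnion₂_subset fun i hi ↦ Metric.ball_subset_ball' (by
      rw [dist_comm]
      linarith [hp i hi])
  have hvol := measure_mono (μ := volume) hsub
  rw [measure_biUnion_finset hdisj fun _ _ ↦ measurableSet_ball] at hvol
  rw [Finset.sum_congr rfl fun i _ ↦ UpperHalfPlane.volume_ball (p i) hs, Finset.sum_const,
    nsmul_eq_mul, UpperHalfPlane.volume_ball z (add_nonneg hj hs)] at hvol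
  rw [← ENNReal.ofReal_natCast, ← ENNReal.ofReal_mul (by positivity),
    ENNReal.ofReal_le_ofReal_iff (by positivity)] at hvol
  have hlow : (s / 2) ^ 2 ≤ sinh (s / 2) ^ 2 := by
    gcongr
    exact self_le_sinh_iff.2 (by linarith)
  have hup := sinh_sq_le_exp_div_four (x := (j + s) / 2) (by linarith)
  rw [mul_div_cancel₀ _ (two_ne_zero' ℝ)] at hup
  have hvol' : (F.card : ℝ) * sinh (s / 2) ^ 2 ≤ sinh ((j + s) / 2) ^ 2 := by
    refine le_of_mul_le_mul_left ?_ (by positivity : 0 < 4 * π)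
    linarith
  have := mul_le_mul_of_nonneg_left hlow (Nat.cast_nonneg (α := ℝ) F.card)
  linarith

theorem counting_hyperbolic_orbit_points (r : ℝ) (hr0 : 0 < r) (hr2 : r ≤ 2)
    (Γ : Subgroup (ℍ ≃ᵢ ℍ))
    (hsys : ∀ γ ∈ Γ, γ ≠ 1 → ∀ z : ℍ, 2 * r ≤ dist z (γ z))
    (j : ℝ) (hj : 0 < j) (z : ℍ) :
    {γ : ℍ ≃ᵢ ℍ | γ ∈ Γ ∧ γ ≠ 1 ∧ dist z (γ z) ≤ j}.Finite ∧
      ({γ : ℍ ≃ᵢ ℍ | γ ∈ Γ ∧ γ ≠ 1 ∧ dist z (γ z) ≤ j}.ncard : ℝ) ≤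
        4 * Real.exp (1 + j) / r ^ 2 := by
  set S := {γ : ℍ ≃ᵢ ℍ | γ ∈ Γ ∧ γ ≠ 1 ∧ dist z (γ z) ≤ j}
  have hcard (F : Finset (ℍ ≃ᵢ ℍ)) (hF : (F : Set (ℍ ≃ᵢ ℍ)) ⊆ S) :
      (F.card : ℝ) ≤ 4 * exp (1 + j) / r ^ 2 := by
    have hsep : (F : Set (ℍ ≃ᵢ ℍ)).Pairwise fun γ δ ↦ 2 * (r / 2) ≤ dist (γ z) (δ z) := by
      intro γ hγ δ hδ hne
      have h := hsys (γ⁻¹ * δ) (Γ.mul_mem (Γ.inv_mem (hF hγ).1) (hF hδ).1)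
        (fun h ↦ hne (inv_mul_eq_one.1 h)) z
      rw [← γ.dist_eq, IsometryEquiv.mul_apply, IsometryEquiv.apply_inv_self] at h
      linarith
    have h := card_mul_sq_le_exp_of_separated F (fun γ ↦ γ z) z (by positivity) hj.le hsep
      fun γ hγ ↦ (hF hγ).2.2
    have hexp : exp (j + r / 2) ≤ exp (1 + j) := exp_le_exp.2 (by linarith)
    rw [le_div_iff₀ (by positivity)]
    linarith
  have hfin : S.Finite := by
    by_contra hinf
    obtain ⟨n, hn⟩ := exists_nat_gt (4 * exp (1 + j) / r ^ 2)
    obtain ⟨F, hFS, hFn⟩ := Set.Infinite.exists_subset_card_eq hinf n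
    exact absurd (hcard F hFS) (by rw [hFn]; exact not_le.2 hn)
  refine ⟨hfin, ?_⟩
  rw [ncard_eq_toFinset_card S hfin]
  exact hcard _ (by simp)
end
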